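/- arXiv:2505.03609 — 2 statements merged into one kernel-verified Lean document; each statement's English description precedes it below -/
import Mathlib

section
/- (Momentum balance law) Let d ≥ 1, let I ⊆ ℝ be an open interval, let u : I × ℝ^d → ℂ be smooth, and let g^{αβ} : I × ℝ^d → ℝ (α, β = 1, …, d) be smooth with g^{αβ} = g^{βα}; write h^{αβ} := g^{αβ} − δ_{αβ}. Define 𝔑 := i ∂_t u + Σ_{α,β=1}^d ∂_α ( g^{αβ} ∂_β u ). Then for each k ∈ {1, …, d} the following identity holds pointwise on I × ℝ^d: − ∂_t Im( u ∂_k ū ) − Σ_{α,β=1}^d Re ∂_k ∂_α ( u · g^{αβ} ∂_β ū ) + 2 Σ_{α,β=1}^d Re ∂_α ( (∂_k u) · g^{αβ} ∂_β ū ) = − Re( u ∂_k 𝔑̄ ) + Re( 𝔑 ∂_k ū ) − Σ_{α,β=1}^d Re( (∂_α u) (∂_k h^{αβ}) (∂_β ū) ). -/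
open MeasureTheory ComplexConjugate

noncomputable section

/-- Partial derivative `∂_α` of a complex-valued function on `ℝ^d`. -/
def pdC {d : ℕ} (α : Fin d) (f : EuclideanSpace ℝ (Fin d) → ℂ)
    (x : EuclideanSpace ℝ (Fin d)) : ℂ :=
  fderiv ℝ f x (EuclideanSpace.single α 1)

/-- Partial derivative `∂_α` of a real-valued function on `ℝ^d`. -/
def pdR {d : ℕ} (α : Fin d) (f : EuclideanSpace ℝ (Fin d) → ℝ)
    (x : EuclideanSpace ℝ (Fin d)) : ℝ :=
  fderiv ℝ f x (EuclideanSpace.single α 1)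

lemma minSmoothness_two_le_top : minSmoothness ℝ 2 ≤ ((⊤ : ℕ∞) : WithTop ℕ∞) := by
  rw [minSmoothness_of_isRCLikeNormedField]
  exact WithTop.coe_le_coe.2 (le_top : (2 : ℕ∞) ≤ ⊤)

section PartialDerivatives

variable {d : ℕ} {f g : EuclideanSpace ℝ (Fin d) → ℂ} {x : EuclideanSpace ℝ (Fin d)}

lemma contDiff_pdC (hf : ContDiff ℝ (⊤ : ℕ∞) f) (α : Fin d) :
    ContDiff ℝ (⊤ : ℕ∞) (pdC α f) :=
  (hf.fderiv_right (m := (⊤ : ℕ∞)) (by simp)).clm_apply contDiff_const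

lemma pdC_add (α : Fin d) (hf : DifferentiableAt ℝ f x) (hg : DifferentiableAt ℝ g x) :
    pdC α (fun y => f y + g y) x = pdC α f x + pdC α g x := by
  simp [pdC, fderiv_fun_add hf hg]

lemma pdC_mul (α : Fin d) (hf : DifferentiableAt ℝ f x) (hg : DifferentiableAt ℝ g x) :
    pdC α (fun y => f y * g y) x = pdC α f x * g x + f x * pdC α g x := by
  simp [pdC, fderiv_fun_mul hf hg]
  ring

lemma pdC_const_mul (α : Fin d) (c : ℂ) (hf : DifferentiableAt ℝ f x) :
    pdC α (fun y => c * f y) x = c * pdC α f x := by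
  simp [pdC, fderiv_const_mul hf]

lemma pdC_sum {ι : Type*} (s : Finset ι) (α : Fin d) {F : ι → EuclideanSpace ℝ (Fin d) → ℂ}
    (hF : ∀ i ∈ s, DifferentiableAt ℝ (F i) x) :
    pdC α (fun y => ∑ i ∈ s, F i y) x = ∑ i ∈ s, pdC α (F i) x := by
  simp [pdC, fderiv_fun_sum hF]

lemma pdC_conj (α : Fin d) (hf : DifferentiableAt ℝ f x) :
    pdC α (fun y => conj (f y)) x = conj (pdC α f x) := by
  have h : HasFDerivAt (fun y => conj (f y))
      ((Complex.conjCLE : ℂ →L[ℝ] ℂ).comp (fderiv ℝ f x)) x :=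
    (Complex.conjCLE : ℂ →L[ℝ] ℂ).hasFDerivAt.comp x hf.hasFDerivAt
  simp [pdC, h.fderiv]

lemma pdC_ofReal (α : Fin d) {r : EuclideanSpace ℝ (Fin d) → ℝ} (hr : DifferentiableAt ℝ r x) :
    pdC α (fun y => (r y : ℂ)) x = (pdR α r x : ℂ) := by
  have h : HasFDerivAt (fun y => (r y : ℂ)) (Complex.ofRealCLM.comp (fderiv ℝ r x)) x :=
    Complex.ofRealCLM.hasFDerivAt.comp x hr.hasFDerivAt
  simp [pdC, pdR, h.fderiv]

lemma pdC_comm (hf : ContDiff ℝ (⊤ : ℕ∞) f) (α β : Fin d) :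
    pdC α (pdC β f) x = pdC β (pdC α f) x := by
  have hd : DifferentiableAt ℝ (fderiv ℝ f) x :=
    (hf.fderiv_right (m := (⊤ : ℕ∞)) (by simp)).differentiable (by simp) x
  have key : ∀ γ δ : Fin d, pdC γ (pdC δ f) x =
      fderiv ℝ (fderiv ℝ f) x (EuclideanSpace.single γ 1) (EuclideanSpace.single δ 1) := by
    intro γ δ
    have h := hd.hasFDerivAt.clm_apply
      (hasFDerivAt_const (EuclideanSpace.single δ (1 : ℝ)) x)
    change fderiv ℝ (fun y => fderiv ℝ f y (EuclideanSpace.single δ 1)) x _ = _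
    rw [h.fderiv]
    simp
  rw [key, key]
  exact (hf.contDiffAt.isSymmSndFDerivAt minSmoothness_two_le_top) _ _

lemma contDiff_conj (hf : ContDiff ℝ (⊤ : ℕ∞) f) :
    ContDiff ℝ (⊤ : ℕ∞) (fun y => conj (f y)) :=
  (Complex.conjCLE : ℂ →L[ℝ] ℂ).contDiff.comp hf

lemma contDiff_ofReal_comp {r : EuclideanSpace ℝ (Fin d) → ℝ} (hr : ContDiff ℝ (⊤ : ℕ∞) r) :
    ContDiff ℝ (⊤ : ℕ∞) (fun y => (r y : ℂ)) :=
  Complex.ofRealCLM.contDiff.comp hr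

lemma pdR_sub_const (α : Fin d) (r : EuclideanSpace ℝ (Fin d) → ℝ) (c : ℝ) :
    pdR α (fun y => r y - c) x = pdR α r x := by
  simp [pdR, fderiv_sub_const]

end PartialDerivatives

section TimeSlices

lemma DifferentiableAt.hasDerivAt_fst_slice {E F : Type*} [NormedAddCommGroup E]
    [NormedSpace ℝ E] [NormedAddCommGroup F] [NormedSpace ℝ F] {Φ : ℝ × E → F} {t : ℝ} {x : E}
    (h : DifferentiableAt ℝ Φ (t, x)) :
    HasDerivAt (fun s => Φ (s, x)) (fderiv ℝ Φ (t, x) (1, 0)) t :=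
  HasFDerivAt.comp_hasDerivAt (f := fun s => (s, x)) t h.hasFDerivAt
    ((hasDerivAt_id t).prodMk (hasDerivAt_const t x))

lemma DifferentiableAt.hasFDerivAt_snd_slice {E F : Type*} [NormedAddCommGroup E]
    [NormedSpace ℝ E] [NormedAddCommGroup F] [NormedSpace ℝ F] {Φ : ℝ × E → F} {t : ℝ} {x : E}
    (h : DifferentiableAt ℝ Φ (t, x)) :
    HasFDerivAt (fun y => Φ (t, y))
      ((fderiv ℝ Φ (t, x)).comp (ContinuousLinearMap.inr ℝ ℝ E)) x :=
  HasFDerivAt.comp (f := fun y => (t, y)) x h.hasFDerivAt (hasFDerivAt_prodMk_right t x)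

variable {d : ℕ} {I : Set ℝ} {t : ℝ}

lemma contDiff_slice {E : Type*} [NormedAddCommGroup E] [NormedSpace ℝ E]
    {u : ℝ → EuclideanSpace ℝ (Fin d) → E}
    (hu : ContDiffOn ℝ (⊤ : ℕ∞)
      (fun p : ℝ × EuclideanSpace ℝ (Fin d) => u p.1 p.2) (I ×ˢ Set.univ)) (ht : t ∈ I) :
    ContDiff ℝ (⊤ : ℕ∞) (u t) := by
  rw [← contDiffOn_univ]
  exact hu.comp (f := fun y => (t, y)) (contDiff_const.prodMk contDiff_id).contDiffOn
    (fun y _ => ⟨ht, trivial⟩)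

variable {u : ℝ → EuclideanSpace ℝ (Fin d) → ℂ}

lemma contDiffAt_uncurry (hI : IsOpen I)
    (hu : ContDiffOn ℝ (⊤ : ℕ∞)
      (fun p : ℝ × EuclideanSpace ℝ (Fin d) => u p.1 p.2) (I ×ˢ Set.univ)) (ht : t ∈ I)
    (x : EuclideanSpace ℝ (Fin d)) :
    ContDiffAt ℝ (⊤ : ℕ∞) (fun p : ℝ × EuclideanSpace ℝ (Fin d) => u p.1 p.2) (t, x) :=
  hu.contDiffAt ((hI.prod isOpen_univ).mem_nhds ⟨ht, trivial⟩)

lemma hasDerivAt_time (hI : IsOpen I)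
    (hu : ContDiffOn ℝ (⊤ : ℕ∞)
      (fun p : ℝ × EuclideanSpace ℝ (Fin d) => u p.1 p.2) (I ×ˢ Set.univ)) (ht : t ∈ I)
    (x : EuclideanSpace ℝ (Fin d)) :
    HasDerivAt (fun s => u s x)
      (fderiv ℝ (fun p : ℝ × EuclideanSpace ℝ (Fin d) => u p.1 p.2) (t, x) (1, 0)) t :=
  ((contDiffAt_uncurry hI hu ht x).differentiableAt (by simp)).hasDerivAt_fst_slice

lemma pdC_eq_fderiv_uncurry (hI : IsOpen I)
    (hu : ContDiffOn ℝ (⊤ : ℕ∞)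
      (fun p : ℝ × EuclideanSpace ℝ (Fin d) => u p.1 p.2) (I ×ˢ Set.univ)) (ht : t ∈ I)
    (x : EuclideanSpace ℝ (Fin d)) (k : Fin d) :
    pdC k (u t) x = fderiv ℝ (fun p : ℝ × EuclideanSpace ℝ (Fin d) => u p.1 p.2) (t, x)
      (0, EuclideanSpace.single k 1) := by
  have h := ((contDiffAt_uncurry hI hu ht x).differentiableAt (by simp)).hasFDerivAt_snd_slice
  have h' : fderiv ℝ (u t) x = _ := h.fderiv
  rw [pdC, h']
  simp

lemma contDiff_time_deriv (hI : IsOpen I)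
    (hu : ContDiffOn ℝ (⊤ : ℕ∞)
      (fun p : ℝ × EuclideanSpace ℝ (Fin d) => u p.1 p.2) (I ×ˢ Set.univ)) (ht : t ∈ I) :
    ContDiff ℝ (⊤ : ℕ∞) (fun y => deriv (fun s => u s y) t) := by
  simp_rw [fun y => (hasDerivAt_time hI hu ht y).deriv]
  rw [contDiff_iff_contDiffAt]
  intro y
  have h := (contDiffAt_uncurry hI hu ht y).fderiv_right (m := (⊤ : ℕ∞)) (by simp)
  exact (h.comp y (f := fun y => (t, y)) (contDiffAt_const.prodMk contDiffAt_id)).clm_apply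
    contDiffAt_const

lemma hasDerivAt_pdC (hI : IsOpen I)
    (hu : ContDiffOn ℝ (⊤ : ℕ∞)
      (fun p : ℝ × EuclideanSpace ℝ (Fin d) => u p.1 p.2) (I ×ˢ Set.univ)) (ht : t ∈ I)
    (x : EuclideanSpace ℝ (Fin d)) (k : Fin d) :
    HasDerivAt (fun s => pdC k (u s) x) (pdC k (fun y => deriv (fun s => u s y) t) x) t := by
  have hc := contDiffAt_uncurry hI hu ht x
  have hd := (hc.fderiv_right (m := (⊤ : ℕ∞)) (by simp)).differentiableAt (by simp)
  have h1 := hd.hasDerivAt_fst_slice.clm_apply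
    (hasDerivAt_const t ((0 : ℝ), EuclideanSpace.single k (1 : ℝ)))
  have h2 := hd.hasFDerivAt_snd_slice.clm_apply
    (hasFDerivAt_const ((1 : ℝ), (0 : EuclideanSpace ℝ (Fin d))) x)
  refine HasDerivAt.congr_of_eventuallyEq ?_ (Filter.eventually_of_mem (hI.mem_nhds ht)
    fun s hs => pdC_eq_fderiv_uncurry hI hu hs x k)
  convert h1 using 1
  simp_rw [fun y => (hasDerivAt_time hI hu ht y).deriv]
  rw [pdC, h2.fderiv]
  simpa using (hc.isSymmSndFDerivAt minSmoothness_two_le_top) _ _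

end TimeSlices

section ProductExpansions

variable {d : ℕ} {v : EuclideanSpace ℝ (Fin d) → ℂ} {r : EuclideanSpace ℝ (Fin d) → ℝ}

lemma pdC_mul_flux {w : EuclideanSpace ℝ (Fin d) → ℂ} (hw : ContDiff ℝ (⊤ : ℕ∞) w)
    (hv : ContDiff ℝ (⊤ : ℕ∞) v) (hr : ContDiff ℝ (⊤ : ℕ∞) r) (α β : Fin d)
    (x : EuclideanSpace ℝ (Fin d)) :
    pdC α (fun y => w y * (r y : ℂ) * conj (pdC β v y)) x
      = pdC α w x * ((r x : ℂ) * conj (pdC β v x))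
        + w x * conj (pdC α (fun y => (r y : ℂ) * pdC β v y) x) := by
  have hR : ContDiff ℝ (⊤ : ℕ∞) (fun y => (r y : ℂ) * pdC β v y) :=
    (contDiff_ofReal_comp hr).mul (contDiff_pdC hv β)
  have e : (fun y => w y * (r y : ℂ) * conj (pdC β v y))
      = fun y => w y * conj ((r y : ℂ) * pdC β v y) := by
    ext y
    simp [mul_assoc]
  rw [e, pdC_mul α (hw.differentiable (by simp) x)
    ((contDiff_conj hR).differentiable (by simp) x), pdC_conj α (hR.differentiable (by simp) x)]
  simp

lemma pdC_pdC_mul_flux (hv : ContDiff ℝ (⊤ : ℕ∞) v) (hr : ContDiff ℝ (⊤ : ℕ∞) r)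
    (k α β : Fin d) (x : EuclideanSpace ℝ (Fin d)) :
    pdC k (fun y => pdC α (fun w => v w * (r w : ℂ) * conj (pdC β v w)) y) x
      = pdC k (pdC α v) x * ((r x : ℂ) * conj (pdC β v x))
        + pdC α v x * ((pdR k r x : ℂ) * conj (pdC β v x)
          + (r x : ℂ) * conj (pdC k (pdC β v) x))
        + pdC k v x * conj (pdC α (fun y => (r y : ℂ) * pdC β v y) x)
        + v x * conj (pdC k (pdC α (fun y => (r y : ℂ) * pdC β v y)) x) := by
  have hA := contDiff_pdC hv
  have hB := contDiff_conj (hA β)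
  have hC := contDiff_ofReal_comp hr
  have hP := contDiff_pdC (hC.mul (hA β)) α
  have hP' := contDiff_conj hP
  have ha := (hA α).differentiable (by simp) x
  have hb := hB.differentiable (by simp) x
  have hc := hC.differentiable (by simp) x
  have hv' := hv.differentiable (by simp) x
  have hp := hP'.differentiable (by simp) x
  simp_rw [fun y => pdC_mul_flux hv hv hr α β y]
  rw [pdC_add k (ha.fun_mul (hc.fun_mul hb)) (hv'.fun_mul hp), pdC_mul k ha (hc.fun_mul hb), pdC_mul k hc hb,
    pdC_mul k hv' hp, pdC_conj k ((hA β).differentiable (by simp) x),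
    pdC_conj k (hP.differentiable (by simp) x), pdC_ofReal k (hr.differentiable (by simp) x)]
  ring

end ProductExpansions

/-- **Momentum balance law.** For `u` smooth on `I × ℝ^d`, real symmetric smooth
coefficients `g^{αβ}` with `h^{αβ} = g^{αβ} - δ_{αβ}`, and
`𝔑 := i ∂ₜ u + Σ ∂_α(g^{αβ} ∂_β u)`, for each `k` one has pointwise on `I × ℝ^d`:
`-∂ₜ Im(u ∂ₖū) - Σ Re ∂ₖ∂_α(u g^{αβ} ∂_βū) + 2 Σ Re ∂_α((∂ₖu) g^{αβ} ∂_βū)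
  = -Re(u ∂ₖ𝔑̄) + Re(𝔑 ∂ₖū) - Σ Re((∂_αu)(∂ₖh^{αβ})(∂_βū))`. -/
theorem stmt_7 (d : ℕ) (hd : 1 ≤ d) (I : Set ℝ) (hI : IsOpen I)
    (u : ℝ → EuclideanSpace ℝ (Fin d) → ℂ)
    (g : Fin d → Fin d → ℝ → EuclideanSpace ℝ (Fin d) → ℝ)
    (hu : ContDiffOn ℝ (⊤ : ℕ∞)
      (fun p : ℝ × EuclideanSpace ℝ (Fin d) => u p.1 p.2) (I ×ˢ Set.univ))
    (hg : ∀ α β : Fin d, ContDiffOn ℝ (⊤ : ℕ∞)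
      (fun p : ℝ × EuclideanSpace ℝ (Fin d) => g α β p.1 p.2) (I ×ˢ Set.univ))
    (hsym : ∀ (α β : Fin d) (t : ℝ) (x : EuclideanSpace ℝ (Fin d)),
      g α β t x = g β α t x)
    (N : ℝ → EuclideanSpace ℝ (Fin d) → ℂ)
    (hN : ∀ (t : ℝ) (x : EuclideanSpace ℝ (Fin d)), N t x
      = Complex.I * deriv (fun s => u s x) t
        + ∑ α : Fin d, ∑ β : Fin d,
            pdC α (fun y => (g α β t y : ℂ) * pdC β (u t) y) x) :
    ∀ t ∈ I, ∀ x : EuclideanSpace ℝ (Fin d), ∀ k : Fin d,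
      - deriv (fun s => (u s x * conj (pdC k (u s) x)).im) t
        - ∑ α : Fin d, ∑ β : Fin d,
            (pdC k (fun y => pdC α
              (fun w => u t w * (g α β t w : ℂ) * conj (pdC β (u t) w)) y) x).re
        + 2 * ∑ α : Fin d, ∑ β : Fin d,
            (pdC α (fun w =>
              pdC k (u t) w * (g α β t w : ℂ) * conj (pdC β (u t) w)) x).re
      = - (u t x * conj (pdC k (N t) x)).re
        + (N t x * conj (pdC k (u t) x)).re
        - ∑ α : Fin d, ∑ β : Fin d,
            (pdC α (u t) x *
              ((pdR k (fun w => g α β t w - if α = β then 1 else 0) x : ℝ) : ℂ) *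
              conj (pdC β (u t) x)).re := by
  intro t ht x k
  have hv := contDiff_slice hu ht
  have hG : ∀ α β, ContDiff ℝ (⊤ : ℕ∞) (g α β t) := fun α β => contDiff_slice (hg α β) ht
  have hP : ∀ α β, ContDiff ℝ (⊤ : ℕ∞) (pdC α (fun y => (g α β t y : ℂ) * pdC β (u t) y)) :=
    fun α β => contDiff_pdC ((contDiff_ofReal_comp (hG α β)).mul (contDiff_pdC hv β)) α
  have hT := contDiff_time_deriv hI hu ht
  have hdN : pdC k (N t) x = Complex.I * pdC k (fun y => deriv (fun s => u s y) t) x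
      + ∑ α, ∑ β, pdC k (pdC α (fun y => (g α β t y : ℂ) * pdC β (u t) y)) x := by
    have hs : ∀ α, DifferentiableAt ℝ
        (fun z => ∑ β, pdC α (fun y => (g α β t y : ℂ) * pdC β (u t) y) z) x := fun α =>
      DifferentiableAt.fun_sum fun β _ => (hP α β).differentiable (by simp) x
    rw [show N t = _ from funext (hN t),
      pdC_add k ((hT.differentiable (by simp) x).const_mul _)
        (DifferentiableAt.fun_sum fun α _ => hs α),
      pdC_const_mul k _ (hT.differentiable (by simp) x), pdC_sum _ k fun α _ => hs α]
    congr 1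
    exact Finset.sum_congr rfl fun α _ =>
      pdC_sum _ k fun β _ => (hP α β).differentiable (by simp) x
  have hut : HasDerivAt (fun s => u s x) (deriv (fun s => u s x) t) t :=
    (hasDerivAt_time hI hu ht x).differentiableAt.hasDerivAt
  have htime : deriv (fun s => (u s x * conj (pdC k (u s) x)).im) t
      = (deriv (fun s => u s x) t * conj (pdC k (u t) x)
        + u t x * conj (pdC k (fun y => deriv (fun s => u s y) t) x)).im := by
    have hc := (Complex.conjCLE : ℂ →L[ℝ] ℂ).hasFDerivAt.comp_hasDerivAt t
      (hasDerivAt_pdC hI hu ht x k)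
    exact (Complex.imCLM.hasFDerivAt.comp_hasDerivAt t (hut.mul hc)).deriv
  have hswap : ∑ α, ∑ β, (pdC k (pdC α (u t)) x
        * ((g α β t x : ℂ) * conj (pdC β (u t) x))).re
      = ∑ α, ∑ β, (pdC α (u t) x
        * ((g α β t x : ℂ) * conj (pdC k (pdC β (u t)) x))).re := by
    rw [Finset.sum_comm]
    refine Finset.sum_congr rfl fun α _ => Finset.sum_congr rfl fun β _ => ?_
    rw [hsym β α]
    simp
    ring
  rw [htime, hdN, hN t x]
  simp_rw [pdR_sub_const, pdC_pdC_mul_flux hv (hG _ _),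
    pdC_mul_flux (contDiff_pdC hv k) hv (hG _ _), pdC_comm hv _ k]
  simp only [map_add, map_mul, map_sum, Complex.conj_I, mul_add, add_mul, Finset.mul_sum,
    Finset.sum_mul, Complex.add_re, Complex.add_im, Complex.re_sum, Finset.sum_add_distrib, hswap]
  have hconj : ∀ α β, (pdC α (fun y => (g α β t y : ℂ) * pdC β (u t) y) x
      * conj (pdC k (u t) x)).re
      = (pdC k (u t) x * conj (pdC α (fun y => (g α β t y : ℂ) * pdC β (u t) y) x)).re := by
    intro α β
    simp
    ring
  have ht1 : (Complex.I * deriv (fun s => u s x) t * conj (pdC k (u t) x)).re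
      = -(deriv (fun s => u s x) t * conj (pdC k (u t) x)).im := by
    simp
  have ht2 : (u t x * (-Complex.I * conj (pdC k (fun y => deriv (fun s => u s y) t) x))).re
      = (u t x * conj (pdC k (fun y => deriv (fun s => u s y) t) x)).im := by
    simp
    ring
  simp_rw [hconj, ht1, ht2, ← mul_assoc]
  simp only [← Finset.mul_sum]
  ring

end
end

section
/- (Finite-time blow-up solution of the sphere-product SMCF ODE system) Let m, n be real numbers with 0 < m < n, and define, for t ∈ [0, 1/(n−m)), a(t) = (1 − (n−m)t)^{n/(n−m)} and b(t) = (1 − (n−m)t)^{m/(m−n)}. Then a and b are positive on [0, 1/(n−m)) and satisfy a'(t) = − n / b(t) and b'(t) = m / a(t) there; moreover a(t) → 0 and b(t) → +∞ as t → (1/(n−m))⁻. -/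
open Filter

theorem hasDerivAt_one_sub_mul_rpow (k p t : ℝ) (h : 0 < 1 - k * t) :
    HasDerivAt (fun s : ℝ => (1 - k * s) ^ p) (-k * p * (1 - k * t) ^ (p - 1)) t := by
  have h₁ : HasDerivAt (fun s : ℝ => 1 - k * s) (-k) t := by
    simpa using ((hasDerivAt_id t).const_mul k).const_sub 1
  exact h₁.rpow_const (Or.inl h.ne')

theorem tendsto_one_sub_mul_nhdsGT_zero {k : ℝ} (hk : 0 < k) :
    Tendsto (fun s : ℝ => 1 - k * s) (nhdsWithin (1 / k) (Set.Iio (1 / k)))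
      (nhdsWithin 0 (Set.Ioi 0)) := by
  refine tendsto_nhdsWithin_iff.2 ⟨?_, ?_⟩
  · have hc : Continuous fun s : ℝ => 1 - k * s := by fun_prop
    have h := hc.tendsto (1 / k)
    rw [mul_one_div_cancel hk.ne', sub_self] at h
    exact h.mono_left nhdsWithin_le_nhds
  · filter_upwards [self_mem_nhdsWithin] with s hs
    have := (lt_div_iff₀' hk).1 (Set.mem_Iio.1 hs)
    exact sub_pos.2 this

/-- **Finite-time blow-up solution of the sphere-product SMCF ODE system.**
For `0 < m < n`, the functions `a t = (1 - (n-m) t) ^ (n/(n-m))` and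
`b t = (1 - (n-m) t) ^ (m/(m-n))` (real powers), defined for `t < 1/(n-m)`, are
positive on `[0, 1/(n-m))` and satisfy `a' = -n / b`, `b' = m / a` there; moreover
`a → 0` and `b → +∞` as `t → (1/(n-m))⁻`. -/
theorem stmt_14 (m n : ℝ) (hm : 0 < m) (hmn : m < n) (a b : ℝ → ℝ)
    (ha : ∀ t ∈ Set.Iio (1 / (n - m)), a t = (1 - (n - m) * t) ^ (n / (n - m)))
    (hb : ∀ t ∈ Set.Iio (1 / (n - m)), b t = (1 - (n - m) * t) ^ (m / (m - n))) :
    (∀ t ∈ Set.Ico (0 : ℝ) (1 / (n - m)),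
      0 < a t ∧ 0 < b t ∧ HasDerivAt a (-n / b t) t ∧ HasDerivAt b (m / a t) t)
    ∧ Tendsto a (nhdsWithin (1 / (n - m)) (Set.Iio (1 / (n - m)))) (nhds 0)
    ∧ Tendsto b (nhdsWithin (1 / (n - m)) (Set.Iio (1 / (n - m)))) atTop := by
  have hk : 0 < n - m := sub_pos.2 hmn
  have hk' : m - n ≠ 0 := (sub_neg.2 hmn).ne
  have hu := tendsto_one_sub_mul_nhdsGT_zero hk
  refine ⟨fun t ht => ?_, ?_, ?_⟩
  · have hpos : 0 < 1 - (n - m) * t := sub_pos.2 ((lt_div_iff₀' hk).1 ht.2)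
    have hnhds : Set.Iio (1 / (n - m)) ∈ nhds t := Iio_mem_nhds ht.2
    have hat := ha t ht.2
    have hbt := hb t ht.2
    refine ⟨hat ▸ Real.rpow_pos_of_pos hpos _, hbt ▸ Real.rpow_pos_of_pos hpos _, ?_, ?_⟩
    · have hd := (hasDerivAt_one_sub_mul_rpow (n - m) (n / (n - m)) t hpos).congr_of_eventuallyEq
        (eventually_of_mem hnhds ha)
      refine hd.congr_deriv (Eq.symm ?_)
      have he : n / (n - m) - 1 = -(m / (m - n)) := by
        rw [← neg_sub n m]
        field_simp
        ring
      rw [hbt, he, Real.rpow_neg hpos.le, neg_mul, mul_div_cancel₀ _ hk.ne', div_eq_mul_inv]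
    · have hd := (hasDerivAt_one_sub_mul_rpow (n - m) (m / (m - n)) t hpos).congr_of_eventuallyEq
        (eventually_of_mem hnhds hb)
      refine hd.congr_deriv (Eq.symm ?_)
      have he : m / (m - n) - 1 = -(n / (n - m)) := by
        rw [← neg_sub n m]
        field_simp
        ring
      rw [hat, he, Real.rpow_neg hpos.le, neg_sub, mul_div_cancel₀ _ hk', div_eq_mul_inv]
  · have hp : 0 < n / (n - m) := div_pos (hm.trans hmn) hk
    have h := (Real.continuousAt_rpow_const 0 _ (Or.inr hp.le)).tendsto.comp
      (hu.mono_right nhdsWithin_le_nhds)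
    rw [Real.zero_rpow hp.ne'] at h
    exact h.congr' (eventually_of_mem self_mem_nhdsWithin fun t ht => (ha t ht).symm)
  · have hp : m / (m - n) < 0 := div_neg_of_pos_of_neg hm (sub_neg.2 hmn)
    exact ((tendsto_rpow_neg_nhdsGT_zero hp).comp hu).congr'
      (eventually_of_mem self_mem_nhdsWithin fun t ht => (hb t ht).symm)
end
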